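/- Let k be an algebraically closed field, s > 2, m ≥ 0, F = k⟨x₁,…,x_m,y₁⟩ the free associative k-algebra, and L the k-span of its generators. Let f ∈ L^{s−1} be homogeneous of degree s−1 such that y₁·f and f·y₁ are linearly independent, and assume it is NOT the case that s = 2t and f = (g·y₁)^{t−1}·g for some integer t and some g ∈ L. Set W = span{y₁·f, f·y₁}. Then ⋂_{i=0}^{s} L^i·W·L^{s−i} = 0 (intersection inside L^{2s} ⊆ F). -/

import Mathlib

noncomputable section

/-- The span `L` of the generators of the free algebra `k⟨X⟩`
(the degree-one homogeneous component). -/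
def faGens (k X : Type) [Field k] : Submodule k (FreeAlgebra k X) :=
  Submodule.span k (Set.range (FreeAlgebra.ι k : X → FreeAlgebra k X))

namespace FreeAlgebra

variable {k X : Type} [Field k]

/-- The coefficient of the word `w`, as a linear functional on the free algebra. -/
def wordCoeff (w : List X) : FreeAlgebra k X →ₗ[k] k where
  toFun f := (equivMonoidAlgebraFreeMonoid f).coeff (FreeMonoid.ofList w)
  map_add' f g := by simp
  map_smul' c f := by simp

theorem wordCoeff_apply (w : List X) (f : FreeAlgebra k X) :
    wordCoeff w f = (equivMonoidAlgebraFreeMonoid f).coeff (FreeMonoid.ofList w) := rfl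

theorem ext_wordCoeff {f g : FreeAlgebra k X} (h : ∀ w, wordCoeff w f = wordCoeff w g) :
    f = g := by
  apply equivMonoidAlgebraFreeMonoid.injective
  ext w
  exact h (FreeMonoid.toList w)

theorem equivMonoidAlgebraFreeMonoid_ι (z : X) :
    equivMonoidAlgebraFreeMonoid (ι k z) = MonoidAlgebra.single (FreeMonoid.of z) 1 := by
  simp [equivMonoidAlgebraFreeMonoid, MonoidAlgebra.of_apply]

theorem wordCoeff_nil_one : wordCoeff [] (1 : FreeAlgebra k X) = 1 := by
  simp [wordCoeff_apply, MonoidAlgebra.one_def]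

theorem wordCoeff_cons_ι_mul [DecidableEq X] (z b : X) (w : List X) (g : FreeAlgebra k X) :
    wordCoeff (b :: w) (ι k z * g) = if b = z then wordCoeff w g else 0 := by
  rw [wordCoeff_apply, map_mul, equivMonoidAlgebraFreeMonoid_ι]
  split_ifs with h
  · subst h
    rw [MonoidAlgebra.coeff_single_mul_eq_mul_coeff (m₂ := FreeMonoid.ofList w), one_mul,
      wordCoeff_apply]
    intro m' _
    rw [FreeMonoid.ofList_cons]
    exact mul_right_inj _
  · apply MonoidAlgebra.coeff_single_mul_of_forall_mul_ne
    intro d hd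
    exact h (List.cons.inj hd).1.symm

theorem wordCoeff_nil_ι_mul (z : X) (g : FreeAlgebra k X) :
    wordCoeff [] (ι k z * g) = 0 := by
  rw [wordCoeff_apply, map_mul, equivMonoidAlgebraFreeMonoid_ι]
  apply MonoidAlgebra.coeff_single_mul_of_forall_mul_ne
  intro d hd
  exact List.cons_ne_nil _ _ hd

theorem mul_induction_faGens {S : Submodule k (FreeAlgebra k X)} {P : FreeAlgebra k X → Prop}
    (mul : ∀ z, ∀ g ∈ S, P (ι k z * g)) (zero : P 0) (add : ∀ f g, P f → P g → P (f + g))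
    (smul : ∀ (c : k) f, P f → P (c • f))
    {f : FreeAlgebra k X} (hf : f ∈ faGens k X * S) : P f := by
  refine Submodule.mul_induction_on hf (fun l hl g hg => ?_) add
  induction hl using Submodule.span_induction with
  | mem l hl => obtain ⟨z, rfl⟩ := hl; exact mul z g hg
  | zero => rw [zero_mul]; exact zero
  | add a b _ _ ha hb => rw [add_mul]; exact add _ _ ha hb
  | smul c a _ ha => rw [smul_mul_assoc]; exact smul _ _ ha

theorem ι_mem_faGens (z : X) : ι k z ∈ faGens k X :=
  Submodule.subset_span ⟨z, rfl⟩

theorem wordCoeff_eq_zero_of_length_ne {n : ℕ} {f : FreeAlgebra k X} (hf : f ∈ faGens k X ^ n)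
    {w : List X} (hw : w.length ≠ n) : wordCoeff w f = 0 := by
  classical
  induction n generalizing f w with
  | zero =>
    rw [pow_zero, Submodule.mem_one] at hf
    obtain ⟨c, rfl⟩ := hf
    have : FreeMonoid.ofList w ≠ 1 := fun h => hw (congrArg List.length (show w = [] from h))
    rw [Algebra.algebraMap_eq_smul_one, map_smul, wordCoeff_apply, map_one,
      MonoidAlgebra.one_def, MonoidAlgebra.coeff_single, Finsupp.single_eq_of_ne this, smul_zero]
  | succ n ih =>
    rw [pow_succ'] at hf
    refine mul_induction_faGens (P := fun f => wordCoeff w f = 0) (fun z g hg => ?_) (map_zero _)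
      (fun f g hf hg => by rw [map_add, hf, hg, add_zero])
      (fun c f hf => by rw [map_smul, hf, smul_zero]) hf
    cases w with
    | nil => exact wordCoeff_nil_ι_mul z g
    | cons b w =>
      rw [wordCoeff_cons_ι_mul, ih hg (by simpa using hw), ite_self]

theorem ext_of_mem_pow {n : ℕ} {f g : FreeAlgebra k X} (hf : f ∈ faGens k X ^ n)
    (hg : g ∈ faGens k X ^ n) (h : ∀ w : List X, w.length = n → wordCoeff w f = wordCoeff w g) :
    f = g := by
  refine ext_wordCoeff fun w => ?_
  by_cases hw : w.length = n
  · exact h w hw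
  · rw [wordCoeff_eq_zero_of_length_ne hf hw, wordCoeff_eq_zero_of_length_ne hg hw]

theorem wordCoeff_append_mul {n : ℕ} {f : FreeAlgebra k X} (hf : f ∈ faGens k X ^ n)
    (g : FreeAlgebra k X) {u : List X} (hu : u.length = n) (v : List X) :
    wordCoeff (u ++ v) (f * g) = wordCoeff u f * wordCoeff v g := by
  classical
  induction n generalizing f u with
  | zero =>
    rw [pow_zero, Submodule.mem_one] at hf
    obtain ⟨c, rfl⟩ := hf
    obtain rfl := List.length_eq_zero_iff.mp hu
    rw [Algebra.algebraMap_eq_smul_one, smul_mul_assoc, one_mul, map_smul, map_smul,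
      wordCoeff_nil_one, List.nil_append, smul_eq_mul, smul_eq_mul, mul_one]
  | succ n ih =>
    obtain ⟨b, u, rfl⟩ := List.exists_cons_of_length_eq_add_one hu
    rw [pow_succ'] at hf
    refine mul_induction_faGens
      (P := fun f => wordCoeff (b :: u ++ v) (f * g) = wordCoeff (b :: u) f * wordCoeff v g)
      (fun z f hf => ?_) (by rw [zero_mul, map_zero, map_zero, zero_mul])
      (fun f f' hf hf' => by rw [add_mul, map_add, map_add, hf, hf', add_mul])
      (fun c f hf => by rw [smul_mul_assoc, map_smul, map_smul, hf, smul_mul_assoc]) hf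
    rw [mul_assoc, List.cons_append, wordCoeff_cons_ι_mul, wordCoeff_cons_ι_mul,
      ih hf (by simpa using hu), ite_mul, zero_mul]

theorem exists_left_strip {n : ℕ} {f : FreeAlgebra k X} (hf : f ∈ faGens k X ^ (n + 1)) (a : X) :
    ∃ h ∈ faGens k X ^ n, ∀ g w, wordCoeff w (h * g) = wordCoeff (a :: w) (f * g) := by
  classical
  rw [pow_succ'] at hf
  refine mul_induction_faGens
    (P := fun f => ∃ h ∈ faGens k X ^ n, ∀ g w, wordCoeff w (h * g) = wordCoeff (a :: w) (f * g))
    (fun z f hf => ?_) ⟨0, zero_mem _, fun g w => by rw [zero_mul, map_zero, map_zero]⟩ ?_ ?_ hf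
  · by_cases hz : a = z
    · exact ⟨f, hf, fun g w => by rw [mul_assoc, wordCoeff_cons_ι_mul, if_pos hz]⟩
    · exact ⟨0, zero_mem _, fun g w => by
        rw [mul_assoc, wordCoeff_cons_ι_mul, if_neg hz, zero_mul, map_zero]⟩
  · rintro f f' ⟨h, hh, H⟩ ⟨h', hh', H'⟩
    exact ⟨h + h', add_mem hh hh', fun g w => by
      rw [add_mul, add_mul, map_add, map_add, H, H']⟩
  · rintro c f ⟨h, hh, H⟩
    exact ⟨c • h, Submodule.smul_mem _ c hh, fun g w => by
      rw [smul_mul_assoc, smul_mul_assoc, map_smul, map_smul, H]⟩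

theorem exists_eq_smul_pow_of_mul_eq {y a : X} {v : FreeAlgebra k X} (hv : v ∈ faGens k X)
    (hva : wordCoeff [a] v ≠ 0) {n : ℕ} {h : FreeAlgebra k X} (hh : h ∈ faGens k X ^ (2 * n))
    {c : k} (H : ι k y * v * h = c • (h * (ι k y * v))) :
    ∃ d : k, h = d • (ι k y * v) ^ n := by
  classical
  have hyv : ι k y * v ∈ faGens k X ^ 2 := by
    rw [pow_two]; exact Submodule.mul_mem_mul (ι_mem_faGens y) hv
  have hya : wordCoeff [y, a] (ι k y * v) ≠ 0 := by
    rwa [wordCoeff_cons_ι_mul, if_pos rfl]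
  induction n generalizing h with
  | zero =>
    rw [mul_zero, pow_zero, Submodule.mem_one] at hh
    obtain ⟨d, rfl⟩ := hh
    exact ⟨d, by rw [pow_zero, Algebra.algebraMap_eq_smul_one]⟩
  | succ n ih =>
    obtain ⟨h₁, hh₁, H₁⟩ := exists_left_strip (n := 2 * n + 1) hh y
    obtain ⟨h₂, hh₂, H₂⟩ := exists_left_strip hh₁ a
    set e := c / wordCoeff [y, a] (ι k y * v) with he
    have key : h = e • (h₂ * (ι k y * v)) := by
      refine ext_wordCoeff fun w => ?_
      have h1 := wordCoeff_append_mul hyv h (u := [y, a]) rfl w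
      rw [H, map_smul, List.cons_append, List.cons_append, List.nil_append, ← H₁, ← H₂] at h1
      rw [map_smul, he, smul_eq_mul, div_mul_eq_mul_div, eq_div_iff hya, mul_comm, ← h1,
        smul_eq_mul]
    by_cases he0 : e = 0
    · exact ⟨0, by rw [key, he0, zero_smul, zero_smul]⟩
    have hne : ι k y * v ≠ 0 := fun h0 => hya (by rw [h0, map_zero])
    obtain ⟨d, hd⟩ := ih (h := h₂) hh₂ (by
      apply mul_right_cancel₀ hne
      apply smul_right_injective _ he0
      simp only
      rw [key] at H
      rw [smul_mul_assoc, mul_assoc _ h₂, smul_comm e c]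
      simpa only [smul_mul_assoc, mul_smul_comm] using H)
    exact ⟨e * d, by rw [key, hd, smul_mul_assoc, pow_succ, smul_smul]⟩

theorem exists_eq_pow_mul_of_mul_eq [IsAlgClosed k] {y a : X} {v : FreeAlgebra k X}
    (hv : v ∈ faGens k X)
    (hva : wordCoeff [a] v ≠ 0) {n : ℕ} {h : FreeAlgebra k X} (hh : h ∈ faGens k X ^ (2 * n))
    {c : k} (H : ι k y * v * h = c • (h * (ι k y * v))) :
    ∃ g ∈ faGens k X, v * h = (g * ι k y) ^ n * g := by
  obtain ⟨d, rfl⟩ := exists_eq_smul_pow_of_mul_eq hv hva hh H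
  obtain ⟨r, hr⟩ := IsAlgClosed.exists_pow_nat_eq d (Nat.succ_pos n)
  refine ⟨r • v, Submodule.smul_mem _ _ hv, ?_⟩
  have hs : SemiconjBy v (ι k y * v) (v * ι k y) := (mul_assoc v _ _).symm
  rw [mul_smul_comm, (hs.pow_right n).eq, smul_mul_assoc, smul_pow, smul_mul_smul_comm, ← hr,
    pow_succ]

/-- Left and right contraction of an element of `L^i W L^j` by words gives an element of `W`. -/
theorem exists_mem_wordCoeff_append {i n j : ℕ} {W : Submodule k (FreeAlgebra k X)}
    (hW : W ≤ faGens k X ^ n) {q : FreeAlgebra k X}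
    (hq : q ∈ faGens k X ^ i * W * faGens k X ^ j) {p : List X} (hp : p.length = i)
    (r : List X) :
    ∃ w ∈ W, ∀ m : List X, m.length = n → wordCoeff (p ++ (m ++ r)) q = wordCoeff m w := by
  rw [mul_assoc] at hq
  refine Submodule.mul_induction_on hq (fun a ha b hb => ?_) ?_
  · refine Submodule.mul_induction_on hb (fun w hw b _ => ?_) ?_
    · refine ⟨(wordCoeff p a * wordCoeff r b) • w, W.smul_mem _ hw, fun m hm => ?_⟩
      rw [wordCoeff_append_mul ha _ hp, wordCoeff_append_mul (hW hw) _ hm, map_smul, smul_eq_mul]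
      ring
    · rintro b b' ⟨w, hw, H⟩ ⟨w', hw', H'⟩
      exact ⟨w + w', add_mem hw hw', fun m hm => by rw [mul_add, map_add, map_add, H m hm, H' m hm]⟩
  · rintro b b' ⟨w, hw, H⟩ ⟨w', hw', H'⟩
    exact ⟨w + w', add_mem hw hw', fun m hm => by rw [map_add, map_add, H m hm, H' m hm]⟩

end FreeAlgebra

section Words

variable {X : Type}

theorem List.append_lt_append_of_length_eq [LinearOrder X] {m m' : List X}
    (hl : m.length = m'.length) (h : m < m') (r r' : List X) : m ++ r < m' ++ r' := by
  induction m generalizing m' with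
  | nil =>
    obtain rfl := List.length_eq_zero_iff.mp hl.symm
    exact absurd h (lt_irrefl _)
  | cons a m ih =>
    cases m' with
    | nil => simp at hl
    | cons b m' =>
      rw [List.cons_append, List.cons_append, List.cons_lt_cons_iff]
      rw [List.cons_lt_cons_iff] at h
      exact h.imp_right fun ⟨h1, h2⟩ => ⟨h1, ih (by simpa using hl) h2⟩

theorem List.append_le_append_of_length_eq [LinearOrder X] {m m' : List X}
    (hl : m.length = m'.length) (h : m ≤ m') (r : List X) : m ++ r ≤ m' ++ r := by
  rcases h.eq_or_lt with rfl | h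
  · exact le_rfl
  · exact (append_lt_append_of_length_eq hl h r r).le

theorem List.append_le_append_left [LinearOrder X] {m m' : List X} (h : m ≤ m') (p : List X) :
    p ++ m ≤ p ++ m' := by
  rcases h.eq_or_lt with rfl | h
  · exact le_rfl
  · exact (List.append_left_lt h).le

theorem List.cons_le_concat [LinearOrder X] {y : X} (hy : ∀ x, y ≤ x) (u : List X) :
    y :: u ≤ u ++ [y] := by
  induction u with
  | nil => exact le_rfl
  | cons b u ih =>
    rcases (hy b).eq_or_lt with rfl | hb
    · exact append_le_append_left ih [y]
    · exact (List.cons_lt_cons_iff.mpr (Or.inl hb)).le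

theorem List.eq_of_le_of_cons_eq_concat [LinearOrder X] {y : X} (hy : ∀ x, y ≤ x) {u m : List X}
    (hu : y :: u = u ++ [y]) (hl : m.length = u.length) (hm : m ≤ u) : m = u := by
  induction u generalizing m with
  | nil => exact List.length_eq_zero_iff.mp hl
  | cons b u ih =>
    obtain ⟨c, m, rfl⟩ := List.exists_cons_of_length_eq_add_one hl
    obtain ⟨rfl, hu⟩ := List.cons.inj hu
    rcases (hy c).eq_or_lt with rfl | hc
    · rw [ih hu (by simpa using hl) (not_lt.mp fun h => hm.not_gt (List.append_left_lt (l₁ := [y]) h))]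
    · exact absurd (List.cons_lt_cons_iff.mpr (Or.inl hc)) hm.not_gt

/-- If every window of length `N + 2` of the word `M` is `y u` or `u y`, where `u` is not a power of
`y`, then `N` is even, `u` neither starts nor ends with `y`, and `M` is `y u y u` or `u y u y`. -/
theorem window_rigidity {N : ℕ} {y : X} {U M : ℕ → X} (hN : 1 ≤ N) (hUy : U (N + 1) = y)
    (hne : ∃ j < N + 1, U j ≠ y)
    (H : ∀ i ≤ N + 2, (M i = y ∧ ∀ j < N + 1, M (i + j + 1) = U j) ∨
      ∀ j < N + 2, M (i + j) = U j) :
    Even N ∧ U 0 ≠ y ∧ U N ≠ y ∧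
      ((M 0 = y ∧ ∀ j < N + 1, M (0 + j + 1) = U j) ∧
        (M (N + 2) = y ∧ ∀ j < N + 1, M (N + 2 + j + 1) = U j) ∨
      (∀ j < N + 2, M (0 + j) = U j) ∧ ∀ j < N + 2, M (N + 2 + j) = U j) := by
  obtain ⟨j₀, hj₀, hne⟩ := hne
  have hAA : ∀ i, (M i = y ∧ ∀ j < N + 1, M (i + j + 1) = U j) →
      ¬ (M (i + 1) = y ∧ ∀ j < N + 1, M (i + 1 + j + 1) = U j) := by
    rintro i ⟨h1, h2⟩ ⟨h3, h4⟩
    have : ∀ j < N + 1, U j = y := by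
      intro j hj
      induction j with
      | zero => rw [← h2 0 hj]; exact h3
      | succ j ih =>
        rw [← h2 _ hj, ← ih (by omega), ← h4 j (by omega)]
        congr 1; omega
    exact hne (this _ hj₀)
  have hBB : ∀ i, (∀ j < N + 2, M (i + j) = U j) → ¬ (∀ j < N + 2, M (i + 1 + j) = U j) := by
    intro i h1 h2
    have : ∀ d < N + 2, U (N + 1 - d) = y := by
      intro d hd
      induction d with
      | zero => exact hUy
      | succ d ih =>
        rw [← ih (by omega), ← h1 (N + 1 - d) (by omega), ← h2 _ (by omega)]
        congr 1; omega
    refine hne ?_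
    rw [← this (N + 1 - j₀) (by omega)]
    congr 1; omega
  have hAB : ∀ i, i < N + 2 → (M i = y ∧ ∀ j < N + 1, M (i + j + 1) = U j) →
      ∀ j < N + 2, M (i + 1 + j) = U j := fun i hi h =>
    (H (i + 1) (by omega)).resolve_left (hAA i h)
  have hBA : ∀ i, i < N + 2 → (∀ j < N + 2, M (i + j) = U j) →
      M (i + 1) = y ∧ ∀ j < N + 1, M (i + 1 + j + 1) = U j := fun i hi h =>
    (H (i + 1) (by omega)).resolve_right (hBB i h)
  have hper : (∀ j < N, U (j + 2) = U j) ∧ U 1 = y := by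
    rcases H 0 (by omega) with h | h
    · have hB := hAB 0 (by omega) h
      have hA := hBA 1 (by omega) hB
      refine ⟨fun j hj => ?_, ?_⟩
      · rw [← hB _ (by omega), ← hA.2 j (by omega)]
        congr 1; omega
      · rw [← hB 1 (by omega)]; exact hA.1
    · have hA := hBA 0 (by omega) h
      have hB := hAB 1 (by omega) hA
      refine ⟨fun j hj => ?_, ?_⟩
      · rw [← h _ (by omega), ← hB j (by omega)]
        congr 1; omega
      · rw [← h 1 (by omega)]; exact hA.1
  obtain ⟨hper, hU1⟩ := hper
  have hmod : ∀ j < N + 2, U j = U (j % 2) := by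
    intro j hj
    induction j using Nat.strong_induction_on with
    | _ j ih =>
      by_cases h : j < 2
      · rw [Nat.mod_eq_of_lt h]
      · obtain ⟨i, rfl⟩ : ∃ i, j = i + 2 := ⟨j - 2, by omega⟩
        rw [hper i (by omega), ih i (by omega) (by omega), Nat.add_mod_right]
  have hU0 : U 0 ≠ y := by
    intro h0
    apply hne
    rw [hmod _ (by omega)]
    rcases Nat.mod_two_eq_zero_or_one j₀ with h | h <;> rw [h] <;> assumption
  have hev : Even N := by
    by_contra hodd
    rw [Nat.not_even_iff] at hodd
    apply hU0
    rw [← hUy, hmod (N + 1) (by omega)]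
    congr 1; omega
  have hev2 := Nat.even_iff.mp hev
  refine ⟨hev, hU0, ?_, ?_⟩
  · rw [hmod N (by omega), hev2]; exact hU0
  · rcases H 0 (by omega) with h | h
    · left
      have : ∀ i, 2 * i ≤ N + 2 → (M (2 * i) = y ∧ ∀ j < N + 1, M (2 * i + j + 1) = U j) := by
        intro i hi
        induction i with
        | zero => exact h
        | succ i ih => exact hBA (2 * i + 1) (by omega) (hAB (2 * i) (by omega) (ih (by omega)))
      refine ⟨h, ?_⟩
      have h' := this ((N + 2) / 2) (by omega)
      rwa [show 2 * ((N + 2) / 2) = N + 2 by omega] at h'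
    · right
      have : ∀ i, 2 * i ≤ N + 2 → ∀ j < N + 2, M (2 * i + j) = U j := by
        intro i hi
        induction i with
        | zero => exact h
        | succ i ih => exact hAB (2 * i + 1) (by omega) (hBA (2 * i) (by omega) (ih (by omega)))
      refine ⟨h, ?_⟩
      have h' := this ((N + 2) / 2) (by omega)
      rwa [show 2 * ((N + 2) / 2) = N + 2 by omega] at h'

theorem List.getD_concat_self (u : List X) (y : X) (j : ℕ) : (u ++ [y]).getD j y = u.getD j y := by
  rcases lt_trichotomy j u.length with h | h | h
  · exact List.getD_append _ _ _ _ h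
  · subst h; simp
  · rw [List.getD_eq_default _ _ (by simp; omega), List.getD_eq_default _ _ h.le]

theorem List.forall_getD_eq_of_cons_eq_concat {u : List X} {y : X}
    (hu : ∀ j < u.length, u.getD j y = y) : y :: u = u ++ [y] := by
  have : u = List.replicate u.length y := by
    refine List.ext_getElem (by simp) fun i h1 h2 => ?_
    have := hu i h1
    rw [List.getD_eq_getElem _ _ h1] at this
    simp [this]
  rw [this, ← List.replicate_succ, ← List.replicate_succ']

theorem word_rigidity {N : ℕ} {y : X} {u M : List X} (hN : 1 ≤ N) (hu : u.length = N + 1)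
    (hM : M.length = N + 2 + (N + 2)) (hne : y :: u ≠ u ++ [y])
    (H : ∀ p m r, M = p ++ (m ++ r) → m.length = N + 2 → m = y :: u ∨ m = u ++ [y]) :
    Even N ∧ (∃ a u', a ≠ y ∧ u = a :: u') ∧ (∃ u' e, e ≠ y ∧ u = u' ++ [e]) ∧
      (M = (y :: u) ++ (y :: u) ∨ M = (u ++ [y]) ++ (u ++ [y])) := by
  have hwin : ∀ i ≤ N + 2, (M.drop i).take (N + 2) = y :: u ∨
      (M.drop i).take (N + 2) = u ++ [y] := fun i hi =>
    H (M.take i) _ ((M.drop i).drop (N + 2)) (by simp) (by simp; omega)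
  have hget : ∀ i j, j < N + 2 → M.getD (i + j) y = ((M.drop i).take (N + 2)).getD j y := by
    intro i j hj
    simp [List.getD_eq_getElem?_getD, hj]
  have key := window_rigidity (U := fun j => u.getD j y) (M := fun j => M.getD j y) (y := y) hN
    (List.getD_eq_default _ _ hu.le) (by
      by_contra! h
      exact hne (List.forall_getD_eq_of_cons_eq_concat fun j hj => h j (by omega))) (by
      intro i hi
      rcases hwin i hi with h | h
      · left
        refine ⟨?_, fun j hj => ?_⟩
        · have := hget i 0 (by omega)
          rw [h] at this
          simpa using this
        · have := hget i (j + 1) (by omega)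
          rw [h] at this
          simpa [add_assoc] using this
      · right
        intro j hj
        have := hget i j hj
        rwa [h, List.getD_concat_self] at this)
  obtain ⟨hev, h0, hlast, hcase⟩ := key
  refine ⟨hev, ?_, ?_, ?_⟩
  · obtain ⟨a, u', rfl⟩ := List.exists_cons_of_length_eq_add_one hu
    exact ⟨a, u', h0, rfl⟩
  · have hnil : u ≠ [] := by rintro rfl; simp at hu
    obtain ⟨u', e, rfl⟩ := List.eq_nil_or_concat' u |>.resolve_left hnil
    refine ⟨u', e, ?_, rfl⟩
    have : u'.length = N := by simpa using hu
    subst this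
    simpa using hlast
  · have hback : ∀ i ≤ N + 2, ∀ L : List X, L.length = N + 2 →
        (∀ j < N + 2, M.getD (i + j) y = L.getD j y) → (M.drop i).take (N + 2) = L := by
      intro i hi L hL h
      refine List.ext_getElem (by simp; omega) fun j h1 h2 => ?_
      have := h j (by omega)
      rwa [hget i j (by omega), List.getD_eq_getElem _ _ h1, List.getD_eq_getElem _ _ h2] at this
    have hsplit : M = (M.drop 0).take (N + 2) ++ (M.drop (N + 2)).take (N + 2) := by
      rw [List.take_of_length_le (l := M.drop (N + 2)) (by simp; omega), List.drop_zero,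
        List.take_append_drop]
    have hcons : ∀ i ≤ N + 2, (M.getD i y = y ∧ ∀ j < N + 1, M.getD (i + j + 1) y = u.getD j y) →
        (M.drop i).take (N + 2) = y :: u := by
      rintro i hi ⟨h1, h2⟩
      refine hback i hi _ (by simp [hu]) fun j hj => ?_
      cases j with
      | zero => simpa using h1
      | succ j => simpa [add_assoc] using h2 j (by omega)
    have hconc : ∀ i ≤ N + 2, (∀ j < N + 2, M.getD (i + j) y = u.getD j y) →
        (M.drop i).take (N + 2) = u ++ [y] := by
      intro i hi h
      refine hback i hi _ (by simp [hu]) fun j hj => ?_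
      rw [List.getD_concat_self, h j hj]
    rcases hcase with ⟨h, h'⟩ | ⟨h, h'⟩
    · left
      rw [hcons 0 (by omega) h, hcons _ le_rfl h'] at hsplit
      exact hsplit
    · right
      rw [hconc 0 (by omega) h, hconc _ le_rfl h'] at hsplit
      exact hsplit

end Words

section Coefficients

variable {k X : Type} [Field k]

theorem exists_max_word [LinearOrder X] [Finite X] {G : List X → k} {n : ℕ} {m₀ : List X}
    (h₀ : m₀.length = n) (hG : G m₀ ≠ 0) :
    ∃ u : List X, u.length = n ∧ G u ≠ 0 ∧ ∀ m, m.length = n → G m ≠ 0 → m ≤ u := by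
  have hfin : {m : List X | m.length = n ∧ G m ≠ 0}.Finite :=
    (List.finite_length_eq X n).subset fun m hm => hm.1
  obtain ⟨u, hu, hmax⟩ := Set.exists_max_image _ id hfin ⟨m₀, h₀, hG⟩
  exact ⟨u, hu.1, hu.2, fun m h1 h2 => hmax m ⟨h1, h2⟩⟩

/-- `A` and `B` are the coefficient functions of `y * f` and `f * y`, where `F` is that of a
homogeneous element `f` of degree `n`. -/
structure IsYMul (y : X) (n : ℕ) (F A B : List X → k) : Prop where
  left : ∀ m, A (y :: m) = F m
  left_ne : ∀ z m, z ≠ y → A (z :: m) = 0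
  right : ∀ m, m.length = n → B (m ++ [y]) = F m
  right_ne : ∀ m z, m.length = n → z ≠ y → B (m ++ [z]) = 0

namespace IsYMul

variable {y : X} {n : ℕ} {F A B : List X → k}

theorem le_of_left_ne_zero [LinearOrder X] (h : IsYMul y n F A B) {u : List X}
    (hmax : ∀ m, m.length = n → F m ≠ 0 → m ≤ u) {m : List X} (hm : m.length = n + 1)
    (hA : A m ≠ 0) : m ≤ y :: u := by
  obtain ⟨z, m, rfl⟩ := List.exists_cons_of_length_eq_add_one hm
  by_cases hz : z = y
  · subst hz
    rw [h.left] at hA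
    exact List.append_le_append_left (hmax m (by simpa using hm) hA) [z]
  · exact absurd (h.left_ne z m hz) hA

theorem le_of_right_ne_zero [LinearOrder X] (h : IsYMul y n F A B) {u : List X}
    (hu : u.length = n)
    (hmax : ∀ m, m.length = n → F m ≠ 0 → m ≤ u) {m : List X} (hm : m.length = n + 1)
    (hB : B m ≠ 0) : m ≤ u ++ [y] := by
  obtain ⟨m, z, rfl⟩ := (List.eq_nil_or_concat' m).resolve_left (by rintro rfl; simp at hm)
  have hm' : m.length = n := by simpa using hm
  by_cases hz : z = y
  · subst hz
    rw [h.right _ hm'] at hB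
    exact List.append_le_append_of_length_eq (hm'.trans hu.symm) (hmax m hm' hB) [z]
  · exact absurd (h.right_ne m z hm' hz) hB

theorem cons_ne_concat [LinearOrder X] (hy : ∀ x, y ≤ x) (h : IsYMul y n F A B) {u : List X}
    (hu : u.length = n) (hmax : ∀ m, m.length = n → F m ≠ 0 → m ≤ u)
    (hAB : ∃ m, m.length = n + 1 ∧ A m ≠ B m) : y :: u ≠ u ++ [y] := by
  intro heq
  have huniq : ∀ m, m.length = n → F m ≠ 0 → m = u := fun m hm hF =>
    List.eq_of_le_of_cons_eq_concat hy heq (hm.trans hu.symm) (hmax m hm hF)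
  obtain ⟨m, hm, hne⟩ := hAB
  have hA : m ≠ y :: u → A m = 0 := by
    contrapose!
    intro hA
    obtain ⟨z, m, rfl⟩ := List.exists_cons_of_length_eq_add_one hm
    by_cases hz : z = y
    · subst hz
      rw [h.left] at hA
      rw [huniq m (by simpa using hm) hA]
    · exact absurd (h.left_ne z m hz) hA
  have hB : m ≠ u ++ [y] → B m = 0 := by
    contrapose!
    intro hB
    obtain ⟨m, z, rfl⟩ := (List.eq_nil_or_concat' m).resolve_left (by rintro rfl; simp at hm)
    have hm' : m.length = n := by simpa using hm
    by_cases hz : z = y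
    · subst hz
      rw [h.right _ hm'] at hB
      rw [huniq m hm' hB]
    · exact absurd (h.right_ne m z hm' hz) hB
  by_cases hmu : m = y :: u
  · apply hne
    rw [hmu, h.left, heq, h.right u hu]
  · exact hne (by rw [hA hmu, hB (heq ▸ hmu)])

/-- The leading word of a nonzero combination of `y * f` and `f * y` is `y u` or `u y`, where
`u` is the leading word of `f`. -/
theorem eq_cons_or_concat_of_max [LinearOrder X] (hy : ∀ x, y ≤ x) (h : IsYMul y n F A B)
    {u : List X} (hu : u.length = n) (hF : F u ≠ 0) (hmax : ∀ m, m.length = n → F m ≠ 0 → m ≤ u)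
    (hne : y :: u ≠ u ++ [y]) {l μ : k} {m₀ : List X} (hm₀ : m₀.length = n + 1)
    (h₀ : l * A m₀ + μ * B m₀ ≠ 0)
    (hlt : ∀ m, m.length = n + 1 → m₀ < m → l * A m + μ * B m = 0) :
    m₀ = y :: u ∨ m₀ = u ++ [y] := by
  have hle := List.cons_le_concat hy u
  by_cases hμ : μ = 0
  · left
    subst hμ
    simp only [zero_mul, add_zero] at h₀ hlt
    refine le_antisymm (h.le_of_left_ne_zero hmax hm₀ (right_ne_zero_of_mul h₀)) ?_
    by_contra! hcon
    have := hlt _ (by simp [hu]) hcon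
    rw [h.left] at this
    exact mul_ne_zero (left_ne_zero_of_mul h₀) hF this
  · right
    have hAu : A (u ++ [y]) = 0 := by
      by_contra hA
      exact hne (le_antisymm hle (h.le_of_left_ne_zero hmax (by simp [hu]) hA))
    apply le_antisymm
    · by_cases hA : A m₀ = 0
      · rw [hA, mul_zero, zero_add] at h₀
        exact h.le_of_right_ne_zero hu hmax hm₀ (right_ne_zero_of_mul h₀)
      · exact (h.le_of_left_ne_zero hmax hm₀ hA).trans hle
    · by_contra! hcon
      have := hlt _ (by simp [hu]) hcon
      rw [hAu, h.right _ hu, mul_zero, zero_add] at this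
      exact mul_ne_zero hμ hF this

/-- Factorization data for `f`: `f = v * h`, where `a * h` is the part of `f` starting with the
letter `a`, and `y * v * h` is proportional to `h * y * v`. -/
def Factors [DecidableEq X] (y : X) (N : ℕ) (F A : List X → k) : Prop :=
  ∃ (a : X) (v : X → k) (c : k), v a ≠ 0 ∧
    (∀ z m, m.length = N → F (z :: m) = v z * F (a :: m)) ∧
    ∀ m e b, m.length = N → A (m ++ [e, b]) = if e = y then c * (F (a :: m) * v b) else 0

/-- If `h * y * v` lies in the span of `y * f` and `f * y`, and the leading word of `f` neither
starts nor ends with `y`, then `h * y * v` is a multiple of `y * f`. -/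
theorem exists_mul_left_eq [DecidableEq X] {N : ℕ} (h : IsYMul y (N + 1) F A B)
    {u : List X} {a e : X} {u' u'' : List X} (ha : a ≠ y) (he : e ≠ y) (hu : u.length = N + 1)
    (hua : u = a :: u') (hue : u = u'' ++ [e]) (hF : F u ≠ 0)
    {g : List X → k} {v : X → k} {l μ : k}
    (hg : ∀ m e b, m.length = N →
      l * A (m ++ [e, b]) + μ * B (m ++ [e, b]) = if e = y then g m * v b else 0) :
    ∃ l : k, ∀ m e b, m.length = N → l * A (m ++ [e, b]) = if e = y then g m * v b else 0 := by
  have hμ : μ = 0 := by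
    have hl : u''.length = N := by rw [hue] at hu; simpa using hu
    have := hg u'' e y hl
    have h1 : u'' ++ [e, y] = u ++ [y] := by rw [hue]; simp
    rw [if_neg he, h1, h.right _ hu, hua, List.cons_append, h.left_ne _ _ ha, mul_zero, zero_add,
      ← hua] at this
    exact (mul_eq_zero.mp this).resolve_right hF
  subst hμ
  exact ⟨l, by simpa using hg⟩

theorem exists_eq_mul_of_mul_eq_mul [DecidableEq X] {N : ℕ} {g₁ g : List X → k}
    {v₁ : X → k} {m₁ : List X} {b₁ : X} (hm₁ : m₁.length = N) (hg₁ : g₁ m₁ ≠ 0) (hv₁ : v₁ b₁ ≠ 0)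
    {l₁ l : k}
    (h₁ : ∀ m e b, m.length = N → l₁ * A (m ++ [e, b]) = if e = y then g₁ m * v₁ b else 0)
    (h : ∀ m e b, m.length = N → l * A (m ++ [e, b]) = if e = y then g m * v₁ b else 0) :
    ∃ c : k, ∀ m, m.length = N → g m = c * g₁ m := by
  have hl₁ : l₁ ≠ 0 := by
    rintro rfl
    have := h₁ m₁ y b₁ hm₁
    rw [if_pos rfl, zero_mul] at this
    exact mul_ne_zero hg₁ hv₁ this.symm
  refine ⟨l / l₁, fun m hm => ?_⟩
  have e1 := h₁ m y b₁ hm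
  have e2 := h m y b₁ hm
  rw [if_pos rfl] at e1 e2
  field_simp
  apply mul_right_cancel₀ hv₁
  linear_combination l * e1 - l₁ * e2

theorem exists_eq_mul_of_mul_eq_mul' [DecidableEq X] {N : ℕ} {g₁ : List X → k}
    {v₁ v : X → k} {m₁ : List X} {b₁ : X} (hm₁ : m₁.length = N) (hg₁ : g₁ m₁ ≠ 0)
    (hv₁ : v₁ b₁ ≠ 0) {l₁ l : k}
    (h₁ : ∀ m e b, m.length = N → l₁ * A (m ++ [e, b]) = if e = y then g₁ m * v₁ b else 0)
    (h : ∀ m e b, m.length = N → l * A (m ++ [e, b]) = if e = y then g₁ m * v b else 0) :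
    ∃ c : k, ∀ b, v b = c * v₁ b := by
  have hl₁ : l₁ ≠ 0 := by
    rintro rfl
    have := h₁ m₁ y b₁ hm₁
    rw [if_pos rfl, zero_mul] at this
    exact mul_ne_zero hg₁ hv₁ this.symm
  refine ⟨l / l₁, fun b => ?_⟩
  have e1 := h₁ m₁ y b hm₁
  have e2 := h m₁ y b hm₁
  rw [if_pos rfl] at e1 e2
  field_simp
  apply mul_left_cancel₀ hg₁
  linear_combination l * e1 - l₁ * e2

theorem factors_of_proportional [DecidableEq X] {N : ℕ} {v v₁ : X → k} {a b₁ : X} {m₁ : List X}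
    (hm₁ : m₁.length = N) (hF : F (a :: m₁) ≠ 0) (hv₁ : v₁ b₁ ≠ 0) {l₁ d : k}
    (h₁ : ∀ m e b, m.length = N → l₁ * A (m ++ [e, b]) = if e = y then F (a :: m) * v₁ b else 0)
    (hv : ∀ z m, m.length = N → F (z :: m) = v z * F (a :: m)) (hd : ∀ b, v₁ b = d * v b) :
    Factors y N F A := by
  have hl₁ : l₁ ≠ 0 := by
    rintro rfl
    have := h₁ m₁ y b₁ hm₁
    rw [if_pos rfl, zero_mul] at this
    exact mul_ne_zero hF hv₁ this.symm
  refine ⟨a, v, d / l₁, fun h0 => hF (by rw [hv a m₁ hm₁, h0, zero_mul]), hv, fun m e b hm => ?_⟩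
  have := h₁ m e b hm
  split_ifs at this ⊢ with hey
  · rw [hd] at this
    field_simp
    linear_combination this
  · exact (mul_eq_zero.mp this).resolve_left hl₁

theorem eval_left [DecidableEq X] (h : IsYMul y n F A B) (z : X) (m : List X) :
    A (z :: m) = if z = y then F m else 0 := by
  split_ifs with hz
  · rw [hz, h.left]
  · exact h.left_ne z m hz

theorem eval_right [DecidableEq X] (h : IsYMul y n F A B) (m : List X) (z : X)
    (hm : m.length = n) : B (m ++ [z]) = if z = y then F m else 0 := by
  split_ifs with hz
  · rw [hz, h.right m hm]
  · exact h.right_ne m z hm hz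

/-- The case where the intersection contains `α • (y * f * (y * f))`. -/
theorem factors_of_left [DecidableEq X] {N : ℕ} (h : IsYMul y (N + 1) F A B)
    {u : List X} {a e : X} {u' u'' : List X} (ha : a ≠ y) (he : e ≠ y) (hu : u.length = N + 1)
    (hua : u = a :: u') (hue : u = u'' ++ [e]) (hF : F u ≠ 0) {Q : List X → k} {α : k} (hα : α ≠ 0)
    (hQ : ∀ m r, m.length = N + 2 → r.length = N + 2 → Q (m ++ r) = α * A m * A r)
    (H : ∀ p r : List X, p.length = 2 → r.length = N → ∃ l μ : k, ∀ m, m.length = N + 2 →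
      Q (p ++ (m ++ r)) = l * A m + μ * B m) : Factors y N F A := by
  have hu' : u'.length = N := by rw [hua] at hu; simpa using hu
  have fits : ∀ z r, r.length = N → ∃ l : k, ∀ m e b, m.length = N →
      l * A (m ++ [e, b]) = if e = y then F (z :: m) * (F (b :: r)) else 0 := by
    intro z r hr
    obtain ⟨l, μ, hl⟩ := H [y, z] r rfl hr
    refine h.exists_mul_left_eq ha he hu hua hue hF (l := l / α) (μ := μ / α)
      (v := fun b => F (b :: r)) (g := fun m => F (z :: m)) fun m e b hm => ?_
    have h1 := hl (m ++ [e, b]) (by simp [hm])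
    have h2 := hQ (y :: z :: m) (e :: b :: r) (by simp [hm]) (by simp [hr])
    rw [show [y, z] ++ (m ++ [e, b] ++ r) = (y :: z :: m) ++ (e :: b :: r) by simp, h2,
      h.left, h.eval_left] at h1
    have h3 : l / α * A (m ++ [e, b]) + μ / α * B (m ++ [e, b]) =
        F (z :: m) * if e = y then F (b :: r) else 0 := by
      field_simp
      linear_combination -h1
    rw [h3, mul_ite, mul_zero]
  obtain ⟨l₁, h₁⟩ := fits a u' hu'
  rw [hua] at hF
  have hc : ∀ z, ∃ c : k, ∀ m, m.length = N → F (z :: m) = c * F (a :: m) := by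
    intro z
    obtain ⟨l, hl⟩ := fits z u' hu'
    exact exists_eq_mul_of_mul_eq_mul (g₁ := fun m => F (a :: m)) (g := fun m => F (z :: m))
      (v₁ := fun b => F (b :: u')) (b₁ := a) hu' hF hF h₁ hl
  choose v hv using hc
  exact factors_of_proportional (v₁ := fun b => F (b :: u')) (b₁ := a) (d := F (a :: u')) hu' hF hF h₁ hv
    fun b => by rw [hv b u' hu', mul_comm]

/-- The case where the intersection contains an element in which `f * y * (f * y)` occurs. -/
theorem factors_of_right [DecidableEq X] {N : ℕ} (h : IsYMul y (N + 1) F A B)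
    {u : List X} {a e : X} {u' u'' : List X} (ha : a ≠ y) (he : e ≠ y) (hu : u.length = N + 1)
    (hua : u = a :: u') (hue : u = u'' ++ [e]) (hF : F u ≠ 0) {Q : List X → k} {α β γ δ : k}
    (hδ : δ ≠ 0)
    (hQ : ∀ m r, m.length = N + 2 → r.length = N + 2 →
      Q (m ++ r) = (α * A r + β * B r) * A m + (γ * A r + δ * B r) * B m)
    (H : ∀ p r : List X, p.length = 1 → r.length = N + 1 → ∃ l μ : k, ∀ m, m.length = N + 2 →
      Q (p ++ (m ++ r)) = l * A m + μ * B m) : Factors y N F A := by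
  have hu' : u'.length = N := by rw [hua] at hu; simpa using hu
  have hu'' : u''.length = N := by rw [hue] at hu; simpa using hu
  set w : List X → k := fun r => γ * A r + δ * B r with hw
  have fits : ∀ x r, x ≠ y → r.length = N + 1 → ∃ l : k, ∀ m e b, m.length = N →
      l * A (m ++ [e, b]) = if e = y then F (x :: m) * w (b :: r) else 0 := by
    intro x r hx hr
    obtain ⟨l, μ, hl⟩ := H [x] r rfl hr
    refine h.exists_mul_left_eq ha he hu hua hue hF (l := l) (μ := μ)
      (v := fun b => w (b :: r)) (g := fun m => F (x :: m)) fun m e b hm => ?_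
    have h1 := hl (m ++ [e, b]) (by simp [hm])
    have h2 := hQ (x :: m ++ [e]) (b :: r) (by simp [hm]) (by simp [hr])
    rw [show [x] ++ (m ++ [e, b] ++ r) = (x :: m ++ [e]) ++ (b :: r) by simp, h2,
      h.eval_right (x :: m) e (by simp [hm]), List.cons_append, h.left_ne _ _ hx] at h1
    rw [← h1, mul_zero, zero_add, mul_ite, mul_zero]
    simp only [hw, mul_comm]
  rw [hua] at hF hu
  have hr₀ : (u' ++ [y]).length = N + 1 := by simp [hu']
  have hw₀ : w (a :: (u' ++ [y])) ≠ 0 := by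
    simp only [hw]
    rw [h.left_ne _ _ ha, mul_zero, zero_add, ← List.cons_append, h.right _ hu]
    exact mul_ne_zero hδ hF
  obtain ⟨l₁, h₁⟩ := fits a (u' ++ [y]) ha hr₀
  set v₁ : X → k := fun b => w (b :: (u' ++ [y])) with hv₁
  have hp : ∀ r, r.length = N + 1 → ∃ c : k, ∀ b, w (b :: r) = c * v₁ b := by
    intro r hr
    obtain ⟨l, hl⟩ := fits a r ha hr
    exact exists_eq_mul_of_mul_eq_mul' (g₁ := fun m => F (a :: m)) (v₁ := v₁) (b₁ := a)
      (v := fun b => w (b :: r)) hu' hF hw₀ h₁ hl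
  have hwx : ∀ x m, x ≠ y → m.length = N → w (x :: (m ++ [y])) = δ * F (x :: m) := by
    intro x m hx hm
    simp only [hw]
    rw [h.left_ne _ _ hx, mul_zero, zero_add, ← List.cons_append, h.right _ (by simp [hm])]
  have hγ : γ = 0 := by
    obtain ⟨c, hc⟩ := hp u (by simp [hua, hu'])
    have h1 := hc a
    have h2 := hc y
    simp only [hw] at h1 h2
    have hB : ∀ z, B (z :: u) = 0 := fun z => by
      rw [hue, ← List.cons_append, h.right_ne _ _ (by simp [hu'']) he]
    rw [hB, h.left_ne _ _ ha, mul_zero, mul_zero, zero_add] at h1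
    have hc0 : c = 0 := (mul_eq_zero.mp h1.symm).resolve_right hw₀
    rw [hB, h.left, hc0, mul_zero, zero_mul, add_zero, hua] at h2
    exact (mul_eq_zero.mp h2).resolve_right hF
  have hwall : ∀ z m, m.length = N → w (z :: (m ++ [y])) = δ * F (z :: m) := by
    intro z m hm
    simp only [hw]
    rw [hγ, zero_mul, zero_add, ← List.cons_append, h.right _ (by simp [hm])]
  have hv : ∀ z m, m.length = N → F (z :: m) = v₁ z / v₁ a * F (a :: m) := by
    intro z m hm
    obtain ⟨c, hc⟩ := hp (m ++ [y]) (by simp [hm])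
    have h1 := hc a
    have h2 := hc z
    rw [hwall _ m hm] at h1 h2
    have hva : v₁ a ≠ 0 := hw₀
    field_simp
    apply mul_left_cancel₀ hδ
    linear_combination v₁ a * h2 - v₁ z * h1
  exact factors_of_proportional (v₁ := v₁) (b₁ := a) (d := v₁ a) hu' hF hw₀ h₁ hv
    fun b => (mul_div_cancel₀ _ hw₀).symm

theorem factors_of_ne_zero [LinearOrder X] [Finite X] (hy : ∀ x, y ≤ x) {N : ℕ}
    (h : IsYMul y (N + 1) F A B) (hN : 1 ≤ N) (hAB : ∃ m, m.length = N + 2 ∧ A m ≠ B m)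
    {Q : List X → k}
    (H : ∀ i ≤ N + 2, ∀ p r : List X, p.length = i → r.length = N + 2 - i →
      ∃ l μ : k, ∀ m, m.length = N + 2 → Q (p ++ (m ++ r)) = l * A m + μ * B m)
    {M₀ : List X} (hM₀ : M₀.length = N + 2 + (N + 2)) (hQ₀ : Q M₀ ≠ 0) :
    Even N ∧ Factors y N F A := by
  obtain ⟨f₀, hf₀, hF₀⟩ : ∃ m, m.length = N + 1 ∧ F m ≠ 0 := by
    by_contra! h0
    obtain ⟨m, hm, hne⟩ := hAB
    apply hne
    trans 0
    · obtain ⟨z, m, rfl⟩ := List.exists_cons_of_length_eq_add_one hm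
      rw [h.eval_left, h0 m (by simpa using hm), ite_self]
    · obtain ⟨m, z, rfl⟩ := (List.eq_nil_or_concat' m).resolve_left (by rintro rfl; simp at hm)
      have hm' : m.length = N + 1 := by simpa using hm
      rw [h.eval_right _ _ hm', h0 m hm', ite_self]
  obtain ⟨u, hu, hF, hmax⟩ := exists_max_word hf₀ hF₀
  obtain ⟨M, hM, hQM, hMmax⟩ := exists_max_word hM₀ hQ₀
  have hne := h.cons_ne_concat hy hu hmax hAB
  have hlt : y :: u < u ++ [y] := lt_of_le_of_ne (List.cons_le_concat hy u) hne
  have hwin : ∀ p m r, M = p ++ (m ++ r) → m.length = N + 2 → m = y :: u ∨ m = u ++ [y] := by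
    rintro p m r rfl hm
    simp only [List.length_append] at hM
    obtain ⟨l, μ, hl⟩ := H p.length (by omega) p r rfl (by omega)
    refine h.eq_cons_or_concat_of_max hy hu hF hmax hne hm (l := l) (μ := μ) ?_ fun m' hm' hlt' => ?_
    · rwa [← hl m hm]
    · rw [← hl m' hm']
      by_contra hne'
      refine (hMmax (p ++ (m' ++ r)) (by simp; omega) hne').not_gt (List.append_left_lt ?_)
      exact List.append_lt_append_of_length_eq (hm.trans hm'.symm) hlt' r r
  obtain ⟨hev, ⟨a, u', ha, hua⟩, ⟨u'', e, he, hue⟩, hcase⟩ := word_rigidity hN hu hM hne hwin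
  refine ⟨hev, ?_⟩
  have hlc : (y :: u).length = N + 2 := by simp [hu]
  have hlr : (u ++ [y]).length = N + 2 := by simp [hu]
  have A1 : A (y :: u) = F u := h.left u
  have A2 : A (u ++ [y]) = 0 := by rw [hua, List.cons_append, h.left_ne _ _ ha]
  have B1 : B (y :: u) = 0 := by
    have : u''.length = N := by rw [hue] at hu; simpa using hu
    rw [hue, ← List.cons_append, h.right_ne _ _ (by simp [this]) he]
  have B2 : B (u ++ [y]) = F u := h.right u hu
  have left_exp : ∀ m r, m.length = N + 2 → r.length = N + 2 →
      Q (m ++ r) = (Q ((y :: u) ++ r) * A m + Q ((u ++ [y]) ++ r) * B m) / F u := by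
    intro m r hm hr
    obtain ⟨l, μ, hl⟩ := H 0 (by omega) [] r rfl (by omega)
    have h1 := hl _ hm
    have h2 := hl _ hlc
    have h3 := hl _ hlr
    rw [List.nil_append] at h1 h2 h3
    rw [h1, h2, h3, A1, A2, B1, B2]
    field_simp
    ring
  have right_exp : ∀ m r, m.length = N + 2 → r.length = N + 2 →
      Q (m ++ r) = (Q (m ++ (y :: u)) * A r + Q (m ++ (u ++ [y])) * B r) / F u := by
    intro m r hm hr
    obtain ⟨l, μ, hl⟩ := H (N + 2) le_rfl m [] hm (by simp)
    have h1 := hl _ hr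
    have h2 := hl _ hlc
    have h3 := hl _ hlr
    rw [List.append_nil] at h1 h2 h3
    rw [h1, h2, h3, A1, A2, B1, B2]
    field_simp
    ring
  have hQ : ∀ m r, m.length = N + 2 → r.length = N + 2 → Q (m ++ r) =
      (Q ((y :: u) ++ (y :: u)) / F u ^ 2 * A r + Q ((y :: u) ++ (u ++ [y])) / F u ^ 2 * B r) * A m +
      (Q ((u ++ [y]) ++ (y :: u)) / F u ^ 2 * A r +
        Q ((u ++ [y]) ++ (u ++ [y])) / F u ^ 2 * B r) * B m := by
    intro m r hm hr
    rw [left_exp m r hm hr, right_exp _ r hlc hr, right_exp _ r hlr hr]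
    field_simp
  have hF2 : F u ^ 2 ≠ 0 := pow_ne_zero 2 hF
  rcases hcase with hMe | hMe
  · have hz : ∀ M', M'.length = N + 2 + (N + 2) → M < M' → Q M' = 0 := fun M' hM' hlt' => by
      by_contra hne'
      exact (hMmax M' hM' hne').not_gt hlt'
    rw [hMe] at hQM hz
    refine h.factors_of_left ha he hu hua hue hF (div_ne_zero hQM hF2) (fun m r hm hr => ?_)
      (fun p r hp hr => H 2 (by omega) p r hp (by omega))
    rw [hQ m r hm hr, hz ((y :: u) ++ (u ++ [y])) (by simp [hu]; omega) (List.append_left_lt hlt),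
      hz ((u ++ [y]) ++ (y :: u)) (by simp [hu]; omega)
        (List.append_lt_append_of_length_eq (hlc.trans hlr.symm) hlt _ _),
      hz ((u ++ [y]) ++ (u ++ [y])) (by simp [hu]; omega)
        (List.append_lt_append_of_length_eq (hlc.trans hlr.symm) hlt _ _)]
    ring
  · rw [hMe] at hQM
    exact h.factors_of_right ha he hu hua hue hF (div_ne_zero hQM hF2) hQ
      (fun p r hp hr => H 1 (by omega) p r hp (by omega))

end IsYMul

end Coefficients

namespace FreeAlgebra

variable {k X : Type} [Field k]

theorem isYMul_wordCoeff {n : ℕ} {f : FreeAlgebra k X} (hf : f ∈ faGens k X ^ n) (y : X) :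
    IsYMul y n (fun m => wordCoeff m f) (fun m => wordCoeff m (ι k y * f))
      (fun m => wordCoeff m (f * ι k y)) := by
  classical
  have hy : ∀ z, wordCoeff [z] (ι k y) = if z = y then 1 else 0 := fun z => by
    rw [← mul_one (ι k y), wordCoeff_cons_ι_mul, wordCoeff_nil_one]
  constructor
  · intro m; rw [wordCoeff_cons_ι_mul, if_pos rfl]
  · intro z m hz; rw [wordCoeff_cons_ι_mul, if_neg hz]
  · intro m hm; rw [wordCoeff_append_mul hf _ hm, hy, if_pos rfl, mul_one]
  · intro m z hm hz; rw [wordCoeff_append_mul hf _ hm, hy, if_neg hz, mul_zero]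

theorem exists_eq_pow_mul_of_factors [IsAlgClosed k] [Fintype X] [DecidableEq X] {n : ℕ} {y : X}
    {f : FreeAlgebra k X} (hf : f ∈ faGens k X ^ (2 * n + 1))
    (h : IsYMul.Factors y (2 * n) (fun m => wordCoeff m f) (fun m => wordCoeff m (ι k y * f))) :
    ∃ g ∈ faGens k X, f = (g * ι k y) ^ n * g := by
  obtain ⟨a, v, c, hva, hfac, hcomm⟩ := h
  obtain ⟨h, hh, hstrip⟩ := exists_left_strip hf a
  have hcoeff : ∀ w, wordCoeff w h = wordCoeff (a :: w) f := fun w => by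
    simpa using hstrip 1 w
  set V : FreeAlgebra k X := ∑ z, v z • ι k z with hV
  have hVmem : V ∈ faGens k X :=
    Submodule.sum_mem _ fun z _ => Submodule.smul_mem _ _ (ι_mem_faGens z)
  have hVc : ∀ z, wordCoeff [z] V = v z := by
    intro z
    have : ∀ x, wordCoeff [z] (ι k x) = if z = x then (1 : k) else 0 := fun x => by
      rw [← mul_one (ι k x), wordCoeff_cons_ι_mul, wordCoeff_nil_one]
    simp [hV, this]
  have hVmem1 : V ∈ faGens k X ^ 1 := by rwa [pow_one]
  have hyV : ι k y * V ∈ faGens k X ^ 2 := by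
    rw [pow_two]; exact Submodule.mul_mem_mul (ι_mem_faGens y) hVmem
  have hfV : f = V * h := by
    refine ext_of_mem_pow hf ?_ fun w hw => ?_
    · rw [pow_succ']; exact Submodule.mul_mem_mul hVmem hh
    · obtain ⟨z, m, rfl⟩ := List.exists_cons_of_length_eq_add_one hw
      have := wordCoeff_append_mul hVmem1 h (u := [z]) rfl m
      rw [List.singleton_append] at this
      rw [this, hVc, hcoeff]
      exact hfac z m (by simpa using hw)
  have key : ι k y * V * h = c • (h * (ι k y * V)) := by
    refine ext_of_mem_pow (n := 2 * n + 2) ?_ ?_ fun w hw => ?_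
    · rw [add_comm, pow_add]; exact Submodule.mul_mem_mul hyV hh
    · rw [pow_add]; exact Submodule.smul_mem _ _ (Submodule.mul_mem_mul hh hyV)
    · obtain ⟨m, e, b, rfl, hm⟩ : ∃ m e b, w = m ++ [e, b] ∧ m.length = 2 * n := by
        obtain ⟨w, b, rfl⟩ := (List.eq_nil_or_concat' w).resolve_left (by rintro rfl; simp at hw)
        have hw' : w.length = 2 * n + 1 := by simpa using hw
        obtain ⟨w, e, rfl⟩ := (List.eq_nil_or_concat' w).resolve_left (by rintro rfl; simp at hw')
        exact ⟨w, e, b, by simp, by simpa using hw'⟩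
      have h1 := hcomm m e b hm
      simp only at h1
      rw [mul_assoc, ← hfV, h1, map_smul, wordCoeff_append_mul hh _ hm, wordCoeff_cons_ι_mul, hVc,
        hcoeff, smul_eq_mul]
      split_ifs <;> simp
  rw [hfV]
  exact exists_eq_pow_mul_of_mul_eq hVmem (a := a) (by rwa [hVc]) hh key

theorem iInf_pow_mul_span_mul_pow_eq_bot [IsAlgClosed k] [LinearOrder X] [Fintype X] {y : X}
    (hy : ∀ x, y ≤ x) {s : ℕ} (hs : 2 < s) {f : FreeAlgebra k X} (hf : f ∈ faGens k X ^ (s - 1))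
    (hli : LinearIndependent k ![ι k y * f, f * ι k y])
    (hnot : ¬ ∃ (t : ℕ) (g : FreeAlgebra k X),
      g ∈ faGens k X ∧ s = 2 * t ∧ f = (g * ι k y) ^ (t - 1) * g) :
    (⨅ i : Fin (s + 1), faGens k X ^ (i : ℕ) * Submodule.span k {ι k y * f, f * ι k y} *
        faGens k X ^ (s - (i : ℕ))) = ⊥ := by
  obtain ⟨N, rfl⟩ : ∃ N, s = N + 2 := ⟨s - 2, by omega⟩
  rw [show N + 2 - 1 = N + 1 by omega] at hf
  have hyf : ι k y * f ∈ faGens k X ^ (N + 2) := by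
    rw [pow_succ']; exact Submodule.mul_mem_mul (ι_mem_faGens y) hf
  have hfy : f * ι k y ∈ faGens k X ^ (N + 2) := by
    rw [pow_succ]; exact Submodule.mul_mem_mul hf (ι_mem_faGens y)
  have hW : Submodule.span k {ι k y * f, f * ι k y} ≤ faGens k X ^ (N + 2) := by
    rw [Submodule.span_le]
    rintro _ (rfl | rfl)
    exacts [hyf, hfy]
  rw [eq_bot_iff]
  intro q hq
  rw [Submodule.mem_iInf] at hq
  rw [Submodule.mem_bot]
  by_contra hq0
  have hqmem : q ∈ faGens k X ^ (N + 2 + (N + 2)) := by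
    have := hq 0
    simp only [Fin.val_zero, pow_zero, one_mul, Nat.sub_zero] at this
    rw [pow_add]
    exact Submodule.mul_le.mpr (fun a ha b hb => Submodule.mul_mem_mul (hW ha) hb) this
  obtain ⟨M₀, hM₀, hQ₀⟩ : ∃ M : List X, M.length = N + 2 + (N + 2) ∧ wordCoeff M q ≠ 0 := by
    by_contra! h0
    exact hq0 (ext_of_mem_pow hqmem (zero_mem _) fun w hw => by rw [h0 w hw, map_zero])
  have hAB : ∃ m : List X, m.length = N + 2 ∧ wordCoeff m (ι k y * f) ≠ wordCoeff m (f * ι k y) := by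
    by_contra! h0
    have heq := ext_of_mem_pow hyf hfy h0
    have := hli.injective (show ![ι k y * f, f * ι k y] 0 = ![ι k y * f, f * ι k y] 1 from heq)
    exact absurd this (by decide)
  obtain ⟨hev, hfac⟩ := (isYMul_wordCoeff hf y).factors_of_ne_zero hy (by omega) hAB
    (Q := fun m => wordCoeff m q) (fun i hi p r hp hr => by
      obtain ⟨w, hw, H⟩ := exists_mem_wordCoeff_append hW (hq ⟨i, by omega⟩) hp r
      obtain ⟨l, μ, rfl⟩ := Submodule.mem_span_pair.mp hw
      exact ⟨l, μ, fun m hm => by rw [H m hm]; simp⟩) hM₀ hQ₀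
  obtain ⟨n, rfl⟩ := hev.two_dvd
  obtain ⟨g, hg, hfg⟩ := exists_eq_pow_mul_of_factors hf hfac
  exact hnot ⟨n + 1, g, hg, by ring, hfg⟩

end FreeAlgebra

/-- Let `k` be an algebraically closed field, `s > 2`, `m ≥ 0`,
`F = k⟨x₁,…,x_m,y₁⟩` (with `y₁` the generator indexed by `Sum.inr ()`) and `L` the span
of the generators.  Let `f ∈ L^{s−1}` be such that `y₁·f` and `f·y₁` are linearly
independent and NOT of the exceptional form (`s = 2t` and `f = (g·y₁)^{t−1}·g` with
`g ∈ L`).  With `W = span{y₁·f, f·y₁}` one has `⋂_{i=0}^{s} L^i·W·L^{s−i} = 0`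
inside `L^{2s} ⊆ F`. -/
theorem stmt16 (k : Type) [Field k] [IsAlgClosed k] (s m : ℕ) (hs : 2 < s)
    (f : FreeAlgebra k (Fin m ⊕ Unit))
    (hf : f ∈ faGens k (Fin m ⊕ Unit) ^ (s - 1))
    (hli : LinearIndependent k
      ![FreeAlgebra.ι k (Sum.inr () : Fin m ⊕ Unit) * f,
        f * FreeAlgebra.ι k (Sum.inr () : Fin m ⊕ Unit)])
    (hnot : ¬ ∃ (t : ℕ) (g : FreeAlgebra k (Fin m ⊕ Unit)),
      g ∈ faGens k (Fin m ⊕ Unit) ∧ s = 2 * t ∧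
        f = (g * FreeAlgebra.ι k (Sum.inr () : Fin m ⊕ Unit)) ^ (t - 1) * g) :
    (⨅ i : Fin (s + 1), faGens k (Fin m ⊕ Unit) ^ (i : ℕ) *
        Submodule.span k
          {FreeAlgebra.ι k (Sum.inr () : Fin m ⊕ Unit) * f,
           f * FreeAlgebra.ι k (Sum.inr () : Fin m ⊕ Unit)} *
        faGens k (Fin m ⊕ Unit) ^ (s - (i : ℕ))) = ⊥ := by
  have hkey : Function.Injective
      (fun x : Fin m ⊕ Unit => Sum.elim (fun i : Fin m => (i : ℕ) + 1) (fun _ => 0) x) := by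
    rintro (i | i) (j | j) h <;> simp_all [Fin.ext_iff]
  let : LinearOrder (Fin m ⊕ Unit) := LinearOrder.lift' _ hkey
  exact FreeAlgebra.iInf_pow_mul_span_mul_pow_eq_bot (X := Fin m ⊕ Unit) (y := Sum.inr ())
    (fun x => Nat.zero_le (Sum.elim (fun i : Fin m => (i : ℕ) + 1) (fun _ => 0) x)) hs hf hli hnot

end
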